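/- Let T_1,...,T_d be commuting measure-preserving ℤ^r-actions on a standard Borel probability space (X,Σ,μ), and assume the nonconventional ergodic theorem holds for all systems of d−1 commuting ℤ^r-actions (i.e., averages (1/|I_N|)Σ_{n∈I_N+a_N} ∏_{i=2}^d g_i∘S_i^n converge in L^2 independently of the Følner and base-point sequences). Then there is a unique probability measure μ^{*d} on (X^d, Σ^{⊗d}), the Furstenberg self-joining, satisfying μ^{*d}(A_1×...×A_d) = lim_N (1/|I_N|) Σ_{n∈I_N+a_N} ∫_X ∏_{i=1}^d 1_{A_i}∘T_i^n dμ for all A_i ∈ Σ, and this limit is independent of the choice of Følner sequence (I_N) and base-point sequence (a_N). -/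

import Mathlib

open MeasureTheory Filter Finset
open scoped symmDiff ENNReal

namespace FSJ

universe u

theorem exists_hilbert {R : Type u} [CommRing R] [Algebra ℝ R] (τ : R →ₗ[ℝ] ℝ)
    (pos : ∀ x, 0 ≤ τ (x * x)) :
    ∃ (H : Type u) (_ : NormedAddCommGroup H) (_ : InnerProductSpace ℝ H) (_ : CompleteSpace H)
      (ι : R →ₗ[ℝ] H), DenseRange ι ∧ ∀ x y, inner ℝ (ι x) (ι y) = τ (x * y) := by
  let c : PreInnerProductSpace.Core ℝ R :=
    { inner := fun x y => τ (x * y)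
      conj_inner_symm := fun x y => by simp [mul_comm]
      re_inner_nonneg := fun x => by simpa using pos x
      add_left := fun x y z => by simp [add_mul]
      smul_left := fun x y r => by simp }
  letI i1 : SeminormedAddCommGroup R := @InnerProductSpace.Core.toSeminormedAddCommGroup ℝ R _ _ _ c
  letI i2 : InnerProductSpace ℝ R := InnerProductSpace.ofCore c
  refine ⟨UniformSpace.Completion R, inferInstance, inferInstance, inferInstance,
    (UniformSpace.Completion.toComplL (𝕜 := ℝ) (E := R)).toLinearMap, ?_, ?_⟩
  · exact UniformSpace.Completion.denseRange_coe
  · intro x y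
    exact UniformSpace.Completion.inner_coe x y

/-- The seminorm attached to a positive functional. -/
noncomputable def nm {R : Type u} [CommRing R] [Algebra ℝ R] (τ : R →ₗ[ℝ] ℝ) (x : R) : ℝ :=
  Real.sqrt (τ (x * x))

/-- The average of `u` over the finite set `I`. -/
noncomputable def avg {G V : Type*} [AddCommGroup V] [Module ℝ V] (I : Finset G) (u : G → V) : V :=
  (I.card : ℝ)⁻¹ • ∑ n ∈ I, u n

section avg
variable {G V W : Type*} [AddCommGroup V] [Module ℝ V] [AddCommGroup W] [Module ℝ W]

theorem map_avg (L : V →ₗ[ℝ] W) (I : Finset G) (u : G → V) :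
    L (avg I u) = avg I (fun n => L (u n)) := by
  simp [avg]

theorem avg_congr {I : Finset G} {u v : G → V} (h : ∀ n ∈ I, u n = v n) : avg I u = avg I v := by
  simp [avg, Finset.sum_congr rfl h]

theorem avg_sub (I : Finset G) (u v : G → V) :
    avg I (fun n => u n - v n) = avg I u - avg I v := by
  simp [avg, smul_sub]

theorem avg_const {I : Finset G} (hI : I.Nonempty) (v : V) : avg I (fun _ => v) = v := by
  have : (I.card : ℝ) ≠ 0 := by exact_mod_cast hI.card_pos.ne'
  simp [avg, ← Nat.cast_smul_eq_nsmul ℝ, smul_smul, this]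

theorem avg_comm {G' : Type*} (I : Finset G) (J : Finset G') (u : G → G' → V) :
    avg I (fun n => avg J (u n)) = avg J (fun m => avg I (fun n => u n m)) := by
  simp only [avg, ← Finset.smul_sum, smul_smul]
  rw [Finset.sum_comm, mul_comm]

theorem avg_le_avg {I : Finset G} {u v : G → ℝ} (h : ∀ n ∈ I, u n ≤ v n) : avg I u ≤ avg I v := by
  simp only [avg, smul_eq_mul]
  exact mul_le_mul_of_nonneg_left (Finset.sum_le_sum h) (by positivity)

theorem avg_le_const {I : Finset G} (hI : I.Nonempty) {u : G → ℝ} {C : ℝ}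
    (h : ∀ n ∈ I, u n ≤ C) : avg I u ≤ C := by
  rw [← avg_const hI C]
  exact avg_le_avg h

theorem norm_avg_le {E : Type*} [NormedAddCommGroup E] [NormedSpace ℝ E] (I : Finset G)
    (u : G → E) : ‖avg I u‖ ≤ avg I (fun n => ‖u n‖) := by
  simp only [avg, norm_smul, smul_eq_mul]
  refine mul_le_mul (by simp) (norm_sum_le _ _) (by positivity) (by positivity)

theorem avg_mul_const {R : Type*} [CommRing R] [Algebra ℝ R] (I : Finset G) (u : G → R) (x : R) :
    avg I u * x = avg I (fun n => u n * x) := by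
  simp [avg, Finset.sum_mul]

theorem const_mul_avg {R : Type*} [CommRing R] [Algebra ℝ R] (I : Finset G) (u : G → R) (x : R) :
    x * avg I u = avg I (fun n => x * u n) := by
  simp [avg, Finset.mul_sum]

theorem sq_avg_le {I : Finset G} (hI : I.Nonempty) (u : G → ℝ) :
    (avg I u) ^ 2 ≤ avg I (fun n => u n ^ 2) := by
  have hc : (0 : ℝ) < I.card := by exact_mod_cast hI.card_pos
  simp only [avg, smul_eq_mul, mul_pow]
  have := sq_sum_le_card_mul_sum_sq (s := I) (f := u)
  calc ((I.card : ℝ)⁻¹) ^ 2 * (∑ n ∈ I, u n) ^ 2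
      ≤ ((I.card : ℝ)⁻¹) ^ 2 * (I.card * ∑ n ∈ I, u n ^ 2) := by gcongr
    _ = _ := by field_simp

theorem norm_avg_shift_le [AddCommGroup G] [DecidableEq G] {E : Type*} [NormedAddCommGroup E]
    [NormedSpace ℝ E] (I : Finset G) (v : G) (w : G → E) (C : ℝ) (hw : ∀ n, ‖w n‖ ≤ C) :
    ‖avg I (fun n => w (n + v)) - avg I w‖ ≤
      C * (((((I.image (· + v)) ∆ I).card : ℝ)) / (I.card : ℝ)) := by
  have h1 : ∑ n ∈ I, w (n + v) = ∑ n ∈ I.image (· + v), w n := by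
    rw [Finset.sum_image]
    intro a _ b _ h
    simpa using h
  set J := I.image (· + v) with hJ
  have h2 : ∑ n ∈ J, w n - ∑ n ∈ I, w n = ∑ n ∈ J \ I, w n - ∑ n ∈ I \ J, w n := by
    have e1 := Finset.sum_inter_add_sum_sdiff J I w
    have e2 := Finset.sum_inter_add_sum_sdiff I J w
    rw [Finset.inter_comm] at e2
    rw [← e1, ← e2]; abel
  have h3 : (J ∆ I).card = (J \ I).card + (I \ J).card := by
    rw [symmDiff_def]
    exact Finset.card_union_of_disjoint disjoint_sdiff_sdiff
  rw [avg, avg, ← smul_sub, h1, h2, norm_smul, h3]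
  have h4 : ‖∑ n ∈ J \ I, w n - ∑ n ∈ I \ J, w n‖ ≤ C * ((J \ I).card + (I \ J).card) := by
    refine (norm_sub_le _ _).trans ?_
    have a1 := norm_sum_le_of_le (J \ I) (f := w) (n := fun _ => C) (fun n _ => hw n)
    have a2 := norm_sum_le_of_le (I \ J) (f := w) (n := fun _ => C) (fun n _ => hw n)
    simp only [sum_const, nsmul_eq_mul] at a1 a2
    linarith
  have h5 : ‖((I.card : ℝ))⁻¹‖ = (I.card : ℝ)⁻¹ := by simp
  rw [h5]
  calc _ ≤ (I.card : ℝ)⁻¹ * (C * ((J \ I).card + (I \ J).card)) := by gcongr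
    _ = _ := by push_cast; ring
end avg

section nm
variable {R : Type u} [CommRing R] [Algebra ℝ R] {τ : R →ₗ[ℝ] ℝ}

theorem exists_hilbert_nm (pos : ∀ x, 0 ≤ τ (x * x)) :
    ∃ (H : Type u) (_ : NormedAddCommGroup H) (_ : InnerProductSpace ℝ H) (_ : CompleteSpace H)
      (ι : R →ₗ[ℝ] H), DenseRange ι ∧ (∀ x y, inner ℝ (ι x) (ι y) = τ (x * y)) ∧
        ∀ x, ‖ι x‖ = nm τ x := by
  obtain ⟨H, i1, i2, i3, ι, h1, h2⟩ := exists_hilbert τ pos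
  refine ⟨H, i1, i2, i3, ι, h1, h2, fun x => ?_⟩
  rw [nm, ← h2, norm_eq_sqrt_real_inner]

theorem nm_sq (pos : ∀ x, 0 ≤ τ (x * x)) (x : R) : nm τ x ^ 2 = τ (x * x) := Real.sq_sqrt (pos x)

theorem nm_nonneg (x : R) : 0 ≤ nm τ x := Real.sqrt_nonneg _

theorem nm_add_le (pos : ∀ x, 0 ≤ τ (x * x)) (x y : R) : nm τ (x + y) ≤ nm τ x + nm τ y := by
  obtain ⟨H, i1, i2, i3, ι, h1, h2, h3⟩ := exists_hilbert_nm pos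
  simp only [← h3, map_add]
  exact norm_add_le _ _

theorem nm_sub_le (pos : ∀ x, 0 ≤ τ (x * x)) (x y : R) : nm τ (x - y) ≤ nm τ x + nm τ y := by
  obtain ⟨H, i1, i2, i3, ι, h1, h2, h3⟩ := exists_hilbert_nm pos
  simp only [← h3, map_sub]
  exact norm_sub_le _ _

theorem nm_smul (pos : ∀ x, 0 ≤ τ (x * x)) (c : ℝ) (x : R) : nm τ (c • x) = |c| * nm τ x := by
  obtain ⟨H, i1, i2, i3, ι, h1, h2, h3⟩ := exists_hilbert_nm pos
  simp only [← h3, map_smul, norm_smul, Real.norm_eq_abs]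

theorem abs_tau_mul_le (pos : ∀ x, 0 ≤ τ (x * x)) (x y : R) : |τ (x * y)| ≤ nm τ x * nm τ y := by
  obtain ⟨H, i1, i2, i3, ι, h1, h2, h3⟩ := exists_hilbert_nm pos
  simp only [← h3, ← h2]
  exact abs_real_inner_le_norm _ _

theorem abs_tau_le (pos : ∀ x, 0 ≤ τ (x * x)) (x : R) : |τ x| ≤ nm τ x * nm τ 1 := by
  simpa using abs_tau_mul_le pos x 1

theorem nm_avg_le (pos : ∀ x, 0 ≤ τ (x * x)) {G : Type*} (I : Finset G) (u : G → R) :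
    nm τ (avg I u) ≤ avg I (fun n => nm τ (u n)) := by
  obtain ⟨H, i1, i2, i3, ι, h1, h2, h3⟩ := exists_hilbert_nm pos
  simp only [← h3, map_avg]
  exact norm_avg_le _ _

theorem nm_avg_shift_le (pos : ∀ x, 0 ≤ τ (x * x)) {G : Type*} [AddCommGroup G] [DecidableEq G]
    (I : Finset G) (v : G) (w : G → R) (C : ℝ) (hw : ∀ n, nm τ (w n) ≤ C) :
    nm τ (avg I (fun n => w (n + v)) - avg I w) ≤
      C * (((((I.image (· + v)) ∆ I).card : ℝ)) / (I.card : ℝ)) := by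
  obtain ⟨H, i1, i2, i3, ι, h1, h2, h3⟩ := exists_hilbert_nm pos
  simp only [← h3, map_avg, map_sub] at hw ⊢
  exact norm_avg_shift_le I v (fun n => ι (w n)) C hw
end nm

/-- `f` acts by multiplication with norm at most `C`. -/
def MB {R : Type u} [CommRing R] [Algebra ℝ R] (τ : R →ₗ[ℝ] ℝ) (C : ℝ) (f : R) : Prop :=
  0 ≤ C ∧ ∀ h, nm τ (f * h) ≤ C * nm τ h

section MB
variable {R : Type u} [CommRing R] [Algebra ℝ R] {τ : R →ₗ[ℝ] ℝ}

theorem MB.one : MB τ 1 1 := ⟨zero_le_one, fun h => by simp⟩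

theorem MB.mono {C D : ℝ} {f : R} (h : MB τ C f) (hCD : C ≤ D) : MB τ D f :=
  ⟨h.1.trans hCD, fun x => (h.2 x).trans (mul_le_mul_of_nonneg_right hCD (nm_nonneg _))⟩

theorem MB.mul {C D : ℝ} {f g : R} (hf : MB τ C f) (hg : MB τ D g) : MB τ (C * D) (f * g) :=
  ⟨mul_nonneg hf.1 hg.1, fun x => by
    rw [mul_assoc, mul_assoc]
    exact (hf.2 _).trans (mul_le_mul_of_nonneg_left (hg.2 _) hf.1)⟩

theorem MB.prod {ι : Type*} (s : Finset ι) {C : ι → ℝ} {f : ι → R} (h : ∀ i, MB τ (C i) (f i)) :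
    MB τ (∏ i ∈ s, C i) (∏ i ∈ s, f i) := by
  classical
  induction s using Finset.induction_on with
  | empty => simpa using MB.one
  | insert a s ha ih => rw [Finset.prod_insert ha, Finset.prod_insert ha]; exact (h a).mul ih

theorem MB.add (pos : ∀ x, 0 ≤ τ (x * x)) {C D : ℝ} {f g : R} (hf : MB τ C f) (hg : MB τ D g) :
    MB τ (C + D) (f + g) :=
  ⟨add_nonneg hf.1 hg.1, fun x => by
    rw [add_mul, add_mul]
    exact (nm_add_le pos _ _).trans (add_le_add (hf.2 x) (hg.2 x))⟩

theorem MB.smul (pos : ∀ x, 0 ≤ τ (x * x)) {C : ℝ} {f : R} (c : ℝ) (hf : MB τ C f) :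
    MB τ (|c| * C) (c • f) :=
  ⟨mul_nonneg (abs_nonneg _) hf.1, fun x => by
    rw [smul_mul_assoc, nm_smul pos, mul_assoc]
    exact mul_le_mul_of_nonneg_left (hf.2 x) (abs_nonneg _)⟩

theorem MB.avg (pos : ∀ x, 0 ≤ τ (x * x)) {G : Type*} {I : Finset G} (hI : I.Nonempty) {C : ℝ}
    {u : G → R} (h : ∀ n, MB τ C (u n)) : MB τ C (avg I u) := by
  obtain ⟨n0, _⟩ := hI
  refine ⟨(h n0).1, fun x => ?_⟩
  rw [avg_mul_const]
  exact (nm_avg_le pos _ _).trans (avg_le_const ⟨n0, by assumption⟩ fun n _ => (h n).2 x)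

theorem MB.map (S : R →ₐ[ℝ] R) (S' : R →ₐ[ℝ] R) (hS : ∀ x, S (S' x) = x)
    (hp : ∀ x, τ (S x) = τ x) {C : ℝ} {f : R} (hf : MB τ C f) : MB τ C (S f) := by
  have hn : ∀ x, nm τ (S x) = nm τ x := fun x => by rw [nm, nm, ← map_mul, hp]
  refine ⟨hf.1, fun x => ?_⟩
  conv_lhs => rw [← hS x, ← map_mul, hn]
  conv_rhs => rw [← hS x, hn]
  exact hf.2 _
end MB
end FSJ

namespace FSJ

universe u

/-- A system of `d` commuting `G`-actions on an algebra with a positive functional. -/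
structure Sys (G : Type) [AddCommGroup G] (R : Type u) [CommRing R] [Algebra ℝ R] (d : ℕ) where
  τ : R →ₗ[ℝ] ℝ
  pos : ∀ x, 0 ≤ τ (x * x)
  bdd : ∀ f, ∃ C, MB τ C f
  T : Fin d → G → R →ₐ[ℝ] R
  T_zero : ∀ i x, T i 0 x = x
  T_add : ∀ i m n x, T i (m + n) x = T i m (T i n x)
  T_comm : ∀ i j m n x, T i m (T j n x) = T j n (T i m x)
  T_pres : ∀ i n x, τ (T i n x) = τ x

section ulim
variable (p : Ultrafilter ℕ)

/-- Limit along an ultrafilter. -/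
noncomputable def ulim (u : ℕ → ℝ) : ℝ := limUnder (p : Filter ℕ) u

theorem tendsto_ulim {u : ℕ → ℝ} {C : ℝ} (h : ∀ n, |u n| ≤ C) :
    Tendsto u p (nhds (ulim p u)) := by
  have hc : IsCompact (Set.Icc (-C) C) := isCompact_Icc
  obtain ⟨x, _, hx⟩ := hc.ultrafilter_le_nhds (p.map u) (le_principal_iff.2
    (show u ⁻¹' Set.Icc (-C) C ∈ (p : Filter ℕ) from Filter.univ_mem' fun n => abs_le.1 (h n)))
  have : Tendsto u p (nhds x) := hx
  exact tendsto_nhds_limUnder ⟨x, this⟩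

theorem ulim_eq {u : ℕ → ℝ} {x : ℝ} (h : Tendsto u p (nhds x)) : ulim p u = x := h.limUnder_eq
end ulim

namespace Sys
variable {G : Type} [AddCommGroup G] {R : Type u} [CommRing R] [Algebra ℝ R] {d : ℕ}

theorem nm_T (S : Sys G R d) (i : Fin d) (n : G) (x : R) : nm S.τ (S.T i n x) = nm S.τ x := by
  rw [nm, nm, ← map_mul, S.T_pres]

theorem T_neg (S : Sys G R d) (i : Fin d) (n : G) (x : R) : S.T i n (S.T i (-n) x) = x := by
  rw [← S.T_add, add_neg_cancel, S.T_zero]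

theorem T_neg' (S : Sys G R d) (i : Fin d) (n : G) (x : R) : S.T i (-n) (S.T i n x) = x := by
  rw [← S.T_add, neg_add_cancel, S.T_zero]

theorem MB_T (S : Sys G R d) (i : Fin d) (n : G) {C : ℝ} {f : R} (h : MB S.τ C f) :
    MB S.τ C (S.T i n f) :=
  h.map _ (S.T i (-n)) (S.T_neg i n) (S.T_pres i n)

/-- Drop the first action. -/
def tail (S : Sys G R (d + 1)) : Sys G R d where
  τ := S.τ
  pos := S.pos
  bdd := S.bdd
  T i := S.T i.succ
  T_zero i := S.T_zero i.succ
  T_add i := S.T_add i.succ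
  T_comm i j := S.T_comm i.succ j.succ
  T_pres i := S.T_pres i.succ

/-- The multiple averages. -/
noncomputable def A (S : Sys G R d) (I : Finset G) (f : Fin d → R) : R :=
  avg I fun n => ∏ i, S.T i n (f i)

/-- The algebra of uniformly bounded families. -/
def RY (S : Sys G R d) : Subalgebra ℝ (ℕ × G → R) where
  carrier := {F | ∃ C, ∀ k, MB S.τ C (F k)}
  mul_mem' := by
    rintro F F' ⟨C, hC⟩ ⟨D, hD⟩
    exact ⟨C * D, fun k => (hC k).mul (hD k)⟩
  add_mem' := by
    rintro F F' ⟨C, hC⟩ ⟨D, hD⟩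
    exact ⟨C + D, fun k => (hC k).add S.pos (hD k)⟩
  algebraMap_mem' := by
    intro c
    refine ⟨|c| * 1, fun k => ?_⟩
    simp only [Pi.algebraMap_apply, Algebra.algebraMap_eq_smul_one]
    exact MB.one.smul S.pos c

theorem RY_bound (S : Sys G R d) (I : ℕ → Finset G) (hI : ∀ N, (I N).Nonempty) (F : S.RY) :
    ∃ C, ∀ N, |avg (I N) fun n => S.τ (F.1 (N, n))| ≤ C := by
  obtain ⟨C, hC⟩ := F.2
  refine ⟨C * nm S.τ 1 * nm S.τ 1, fun N => ?_⟩
  rw [← Real.norm_eq_abs]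
  refine (norm_avg_le _ _).trans (avg_le_const (hI N) fun n _ => ?_)
  rw [Real.norm_eq_abs]
  refine (abs_tau_le S.pos _).trans (mul_le_mul_of_nonneg_right ?_ (nm_nonneg _))
  simpa using (hC (N, n)).2 1

theorem tendsto_RY (S : Sys G R d) (I : ℕ → Finset G) (hI : ∀ N, (I N).Nonempty)
    (p : Ultrafilter ℕ) (F : S.RY) :
    Tendsto (fun N => avg (I N) fun n => S.τ (F.1 (N, n))) p
      (nhds (ulim p fun N => avg (I N) fun n => S.τ (F.1 (N, n)))) := by
  obtain ⟨C, hC⟩ := S.RY_bound I hI F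
  exact tendsto_ulim p hC

/-- The limiting functional on the algebra of families. -/
noncomputable def τY (S : Sys G R d) (I : ℕ → Finset G) (hI : ∀ N, (I N).Nonempty)
    (p : Ultrafilter ℕ) : S.RY →ₗ[ℝ] ℝ where
  toFun F := ulim p fun N => avg (I N) fun n => S.τ (F.1 (N, n))
  map_add' F F' := by
    apply ulim_eq
    convert! (S.tendsto_RY I hI p F).add (S.tendsto_RY I hI p F') using 2 with N
    simp [avg, Finset.sum_add_distrib, mul_add]
  map_smul' c F := by
    apply ulim_eq
    convert! (S.tendsto_RY I hI p F).const_mul c using 2 with N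
    simp [avg, ← Finset.mul_sum]
    ring

theorem tendsto_τY (S : Sys G R d) (I : ℕ → Finset G) (hI : ∀ N, (I N).Nonempty)
    (p : Ultrafilter ℕ) (F : S.RY) :
    Tendsto (fun N => avg (I N) fun n => S.τ (F.1 (N, n))) p (nhds (S.τY I hI p F)) :=
  S.tendsto_RY I hI p F

/-- The action on families. -/
def TY (S : Sys G R d) (i : Fin d) (m : G) : S.RY →ₐ[ℝ] S.RY where
  toFun F := ⟨fun k => S.T i m (F.1 k), by
    obtain ⟨C, hC⟩ := F.2
    exact ⟨C, fun k => S.MB_T i m (hC k)⟩⟩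
  map_one' := by ext k; simp
  map_mul' F F' := by ext k; simp
  map_zero' := by ext k; simp
  map_add' F F' := by ext k; simp
  commutes' c := by ext k; simp

theorem τY_nonneg (S : Sys G R d) (I : ℕ → Finset G) (hI : ∀ N, (I N).Nonempty)
    (p : Ultrafilter ℕ) (F : S.RY) (h : ∀ k, 0 ≤ S.τ (F.1 k)) : 0 ≤ S.τY I hI p F := by
  refine ge_of_tendsto' (S.tendsto_τY I hI p F) fun N => ?_
  simp only [avg, smul_eq_mul]
  exact mul_nonneg (by positivity) (Finset.sum_nonneg fun n _ => h _)

/-- The limiting system. -/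
noncomputable def ultra (S : Sys G R d) (I : ℕ → Finset G) (hI : ∀ N, (I N).Nonempty)
    (p : Ultrafilter ℕ) : Sys G S.RY d where
  τ := S.τY I hI p
  pos F := S.τY_nonneg I hI p _ fun k => S.pos (F.1 k)
  bdd F := by
    obtain ⟨C, hC⟩ := F.2
    have hC0 : 0 ≤ C := (hC (0, 0)).1
    refine ⟨C, hC0, fun h => ?_⟩
    refine Real.sqrt_le_iff.2 ⟨mul_nonneg hC0 (nm_nonneg _), ?_⟩
    rw [mul_pow, nm_sq fun F => S.τY_nonneg I hI p _ fun k => S.pos (F.1 k)]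
    rw [← smul_eq_mul (C ^ 2), ← map_smul, ← sub_nonneg, ← map_sub]
    refine S.τY_nonneg I hI p _ fun k => ?_
    have h1 := (hC k).2 (h.1 k)
    have h2 := pow_le_pow_left₀ (nm_nonneg _) h1 2
    rw [mul_pow, nm_sq S.pos, nm_sq S.pos] at h2
    simpa using h2
  T := S.TY
  T_zero i F := by ext k; exact S.T_zero i _
  T_add i m n F := by ext k; exact S.T_add i m n _
  T_comm i j m n F := by ext k; exact S.T_comm i j m n _
  T_pres i n F := by
    apply ulim_eq
    refine (S.tendsto_τY I hI p F).congr fun N => ?_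
    exact avg_congr fun m _ => (S.T_pres i n _).symm

theorem A_ultra_apply (S : Sys G R d) (I : ℕ → Finset G) (hI : ∀ N, (I N).Nonempty)
    (p : Ultrafilter ℕ) (J : Finset G) (F : Fin d → S.RY) (k : ℕ × G) :
    ((S.ultra I hI p).A J F).1 k = S.A J (fun i => (F i).1 k) := by
  let e : S.RY →ₐ[ℝ] R := (Pi.evalAlgHom ℝ (fun _ : ℕ × G => R) k).comp S.RY.val
  change e ((S.ultra I hI p).A J F) = _
  rw [A, A]
  rw [show e (avg J fun n => ∏ i, (S.ultra I hI p).T i n (F i)) =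
    avg J (fun n => e (∏ i, (S.ultra I hI p).T i n (F i))) from map_avg e.toLinearMap _ _]
  refine avg_congr fun n _ => ?_
  rw [map_prod]
  rfl

end Sys
end FSJ

namespace FSJ

universe u

/-- Følner sequences. -/
def Folner {G : Type} [AddCommGroup G] [DecidableEq G] (I : ℕ → Finset G) : Prop :=
  (∀ N, (I N).Nonempty) ∧ ∀ v : G, Tendsto
    (fun N => ((((I N).image (· + v)) ∆ (I N)).card : ℝ) / ((I N).card : ℝ)) atTop (nhds 0)

namespace Sys
variable {G : Type} [AddCommGroup G] {R : Type u} [CommRing R] [Algebra ℝ R] {d : ℕ}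

/-- The product of the last `d` functions. -/
def P (S : Sys G R (d + 1)) (g : Fin d → R) (n : G) : R := ∏ i, S.T i.succ n (g i)

theorem exists_MB_P (S : Sys G R (d + 1)) (g : Fin d → R) : ∃ C, ∀ n, MB S.τ C (S.P g n) := by
  choose C hC using fun i => S.bdd (g i)
  exact ⟨∏ i, C i, fun n => MB.prod _ fun i => S.MB_T _ _ (hC i)⟩

/-- The averages as a linear map in the first function. -/
noncomputable def Φ (S : Sys G R (d + 1)) (g : Fin d → R) (J : Finset G) : R →ₗ[ℝ] R where
  toFun h := avg J fun n => S.P g n * S.T 0 n h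
  map_add' x y := by simp [avg, mul_add, Finset.sum_add_distrib]
  map_smul' c x := by simp [avg, ← Finset.smul_sum, smul_smul, mul_comm]

theorem Φ_apply (S : Sys G R (d + 1)) (g : Fin d → R) (J : Finset G) (h : R) :
    S.Φ g J h = avg J fun n => S.P g n * S.T 0 n h := rfl

/-- The formal adjoint of the averages. -/
noncomputable def Ψ (S : Sys G R (d + 1)) (g : Fin d → R) (J : Finset G) (k : R) : R :=
  avg J fun n => S.T 0 (-n) (k * S.P g n)

theorem Ψ_Φ (S : Sys G R (d + 1)) (g : Fin d → R) (J : Finset G) (b h : R) :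
    S.τ (S.Ψ g J b * h) = S.τ (b * S.Φ g J h) := by
  rw [Ψ, Φ_apply, avg_mul_const, const_mul_avg, map_avg, map_avg]
  refine avg_congr fun n _ => ?_
  rw [← S.T_pres 0 n, map_mul, S.T_neg, mul_assoc]

theorem nm_Φ_le (S : Sys G R (d + 1)) {g : Fin d → R} {C : ℝ} (hC : ∀ n, MB S.τ C (S.P g n))
    {J : Finset G} (hJ : J.Nonempty) (h : R) : nm S.τ (S.Φ g J h) ≤ C * nm S.τ h := by
  rw [Φ_apply]
  refine (nm_avg_le S.pos _ _).trans (avg_le_const hJ fun n _ => ?_)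
  refine ((hC n).2 _).trans_eq ?_
  rw [S.nm_T]

theorem MB_Φ (S : Sys G R (d + 1)) {g : Fin d → R} {C D : ℝ} (hC : ∀ n, MB S.τ C (S.P g n))
    {J : Finset G} (hJ : J.Nonempty) {h : R} (hh : MB S.τ D h) : MB S.τ (C * D) (S.Φ g J h) := by
  rw [Φ_apply]
  exact MB.avg S.pos hJ fun n => (hC n).mul (S.MB_T _ _ hh)

theorem A_eq_Φ (S : Sys G R (d + 1)) (f : Fin (d + 1) → R) (J : Finset G) :
    S.A J f = S.Φ (fun i => f i.succ) J (f 0) := by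
  rw [A, Φ_apply]
  refine avg_congr fun n _ => ?_
  rw [Fin.prod_univ_succ, mul_comm]
  rfl

theorem nm_Ψ_le (S : Sys G R (d + 1)) {g : Fin d → R} {C : ℝ} (hC : ∀ n, MB S.τ C (S.P g n))
    {J : Finset G} (hJ : J.Nonempty) (k : R) : nm S.τ (S.Ψ g J k) ≤ C * nm S.τ k := by
  rw [Ψ]
  refine (nm_avg_le S.pos _ _).trans (avg_le_const hJ fun n _ => ?_)
  rw [S.nm_T, mul_comm k]
  exact (hC n).2 _

/-- The functions of the limiting system. -/
def c (S : Sys G R (d + 1)) (f g : Fin d → R) (n : G) (i : Fin d) : R :=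
  g i * S.T 0 (-n) (S.T i.succ n (f i))

/-- Shifted version of `Ψ`. -/
noncomputable def E (S : Sys G R (d + 1)) (f : Fin d → R) (J : Finset G) (b : R) (m : G) : R :=
  avg J fun n => S.T 0 (-n) (b * S.P f (n + m))

theorem P_mul_E (S : Sys G R (d + 1)) (f g : Fin d → R) (J J' : Finset G) (b : R) :
    (avg J' fun m => S.P g m * S.E f J b m) =
      avg J fun n => S.T 0 (-n) b * S.tail.A J' (S.c f g n) := by
  simp only [E, A, const_mul_avg]
  rw [avg_comm]
  refine avg_congr fun n _ => avg_congr fun m _ => ?_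
  have : ∏ i, S.tail.T i m (S.c f g n i) = S.P g m * S.T 0 (-n) (S.P f (n + m)) := by
    rw [P, P, map_prod, ← Finset.prod_mul_distrib]
    refine Finset.prod_congr rfl fun i _ => ?_
    change S.T i.succ m (g i * S.T 0 (-n) (S.T i.succ n (f i))) = _
    rw [map_mul, S.T_comm i.succ 0 m, ← S.T_add, add_comm m n]
  rw [this, map_mul]
  ring

theorem nm_T_Ψ_sub_E_le [DecidableEq G] (S : Sys G R (d + 1)) {f : Fin d → R} {C : ℝ}
    (hC : ∀ n, MB S.τ C (S.P f n)) (J : Finset G) {b : R} (m : G) :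
    nm S.τ (S.T 0 m (S.Ψ f J b) - S.E f J b m) ≤
      C * nm S.τ b * (((((J.image (· + -m)) ∆ J).card : ℝ)) / (J.card : ℝ)) := by
  have := nm_avg_shift_le S.pos J (-m) (fun n => S.T 0 (-n) (b * S.P f (n + m)))
    (C * nm S.τ b) (fun n => by
      rw [S.nm_T, mul_comm b]
      exact (hC _).2 _)
  refine le_trans (le_of_eq ?_) this
  congr 2
  rw [Ψ, show S.T 0 m (avg J fun n => S.T 0 (-n) (b * S.P f n)) =
    avg J (fun n => S.T 0 m (S.T 0 (-n) (b * S.P f n))) from map_avg (S.T 0 m).toLinearMap _ _]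
  refine avg_congr fun n _ => ?_
  rw [← S.T_add]
  congr 2 <;> [abel_nf; (congr 2; abel)]

/-- The key estimate: functions of the form `Ψ` give averages which are Cauchy, by the
inductive hypothesis applied to the limiting system. -/
theorem key [DecidableEq G] (S : Sys G R (d + 1)) (I : ℕ → Finset G) (hI : Folner I)
    (ih : ∀ (R' : Type u) [CommRing R'] [Algebra ℝ R'] (S' : Sys G R' d) (f : Fin d → R'),
      ∀ ε > 0, ∃ N0, ∀ M ≥ N0, ∀ M' ≥ N0, nm S'.τ (S'.A (I M) f - S'.A (I M') f) ≤ ε)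
    (p : Ultrafilter ℕ) (hp : (p : Filter ℕ) ≤ atTop) (f g : Fin d → R) (b : ℕ → R) (D : ℝ)
    (hb : ∀ N, MB S.τ D (b N)) (ε : ℝ) (hε : 0 < ε) :
    ∃ N0, ∀ M ≥ N0, ∀ M' ≥ N0, ∀ᶠ N in (p : Filter ℕ),
      nm S.τ (S.Φ g (I M) (S.Ψ f (I N) (b N)) - S.Φ g (I M') (S.Ψ f (I N) (b N))) ≤ ε := by
  obtain ⟨Cf, hCf⟩ := S.exists_MB_P f
  obtain ⟨Cg, hCg⟩ := S.exists_MB_P g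
  have hD0 : 0 ≤ D := (hb 0).1
  -- approximation of `Φ` of `Ψ`
  have happ : ∀ M, ∀ δ > 0, ∀ᶠ N in (p : Filter ℕ),
      nm S.τ (S.Φ g (I M) (S.Ψ f (I N) (b N)) -
        avg (I M) fun m => S.P g m * S.E f (I N) (b N) m) ≤ δ := by
    intro M δ hδ
    have h1 : ∀ m, Tendsto (fun N => Cg * (Cf * (D * nm S.τ 1) *
        ((((((I N).image (· + -m)) ∆ (I N)).card : ℝ)) / ((I N).card : ℝ)))) p (nhds 0) := by
      intro m
      have := ((hI.2 (-m)).mono_left hp).const_mul (Cf * (D * nm S.τ 1)) |>.const_mul Cg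
      simpa using this
    have h2 : ∀ᶠ N in (p : Filter ℕ), ∀ m ∈ I M, Cg * (Cf * (D * nm S.τ 1) *
        ((((((I N).image (· + -m)) ∆ (I N)).card : ℝ)) / ((I N).card : ℝ))) ≤ δ := by
      rw [Filter.eventually_all_finset]
      intro m _
      exact ((h1 m).eventually_lt_const hδ).mono fun _ h => h.le
    filter_upwards [h2] with N hN
    rw [Φ_apply, ← avg_sub]
    refine (nm_avg_le S.pos _ _).trans (avg_le_const (hI.1 M) fun m hm => ?_)
    rw [← mul_sub]
    refine ((hCg m).2 _).trans (le_trans ?_ (hN m hm))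
    refine mul_le_mul_of_nonneg_left ?_ (hCg 0).1
    refine (S.nm_T_Ψ_sub_E_le hCf (I N) m).trans ?_
    refine mul_le_mul_of_nonneg_right ?_ (by positivity)
    refine mul_le_mul_of_nonneg_left ?_ (hCf 0).1
    simpa using (hb N).2 1
  -- the limiting system
  let Y := S.tail.ultra I hI.1 p
  have hF : ∀ i, ∃ C, ∀ k : ℕ × G, MB S.τ C (S.c f g k.2 i) := by
    intro i
    obtain ⟨C1, h1⟩ := S.bdd (f i)
    obtain ⟨C2, h2⟩ := S.bdd (g i)
    exact ⟨C2 * C1, fun k => h2.mul (S.MB_T _ _ (S.MB_T _ _ h1))⟩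
  let F : Fin d → S.tail.RY := fun i => ⟨fun k => S.c f g k.2 i, hF i⟩
  have hD1 : 0 < D + 1 := by linarith
  obtain ⟨N0, hN0⟩ := ih _ Y F (ε / 4 / (D + 1)) (by positivity)
  refine ⟨N0, fun M hM M' hM' => ?_⟩
  have hY := hN0 M hM M' hM'
  set X := Y.A (I M) F - Y.A (I M') F with hX
  have hXk : ∀ k : ℕ × G, X.1 k = S.tail.A (I M) (S.c f g k.2) - S.tail.A (I M') (S.c f g k.2) := by
    intro k
    have e1 := S.tail.A_ultra_apply I hI.1 p (I M) F k
    have e2 := S.tail.A_ultra_apply I hI.1 p (I M') F k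
    change (Y.A (I M) F).1 k - (Y.A (I M') F).1 k = _
    rw [e1, e2]
  have hlim : Tendsto (fun N => avg (I N) fun n => S.τ (X.1 (N, n) * X.1 (N, n))) p
      (nhds (Y.τ (X * X))) := S.tail.tendsto_τY I hI.1 p (X * X)
  have hlt : Y.τ (X * X) < (ε / 2 / (D + 1)) ^ 2 := by
    rw [← nm_sq Y.pos]
    refine pow_lt_pow_left₀ (lt_of_le_of_lt hY ?_) (nm_nonneg _) two_ne_zero
    gcongr
    linarith
  filter_upwards [happ M (ε / 4) (by positivity), happ M' (ε / 4) (by positivity),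
    hlim.eventually_lt_const hlt] with N h1 h2 h3
  rw [P_mul_E] at h1 h2
  set a1 := S.Φ g (I M) (S.Ψ f (I N) (b N))
  set a2 := S.Φ g (I M') (S.Ψ f (I N) (b N))
  set b1 := avg (I N) fun n => S.T 0 (-n) (b N) * S.tail.A (I M) (S.c f g n)
  set b2 := avg (I N) fun n => S.T 0 (-n) (b N) * S.tail.A (I M') (S.c f g n)
  have h4 : nm S.τ (b1 - b2) ≤ ε / 2 := by
    have e : b1 - b2 = avg (I N) fun n => S.T 0 (-n) (b N) * X.1 (N, n) := by
      rw [← avg_sub]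
      refine avg_congr fun n _ => ?_
      rw [hXk, mul_sub]
    rw [e]
    have e2 : avg (I N) (fun n => nm S.τ (X.1 (N, n))) ≤ ε / 2 / (D + 1) := by
      refine le_of_lt (lt_of_pow_lt_pow_left₀ 2 (by positivity) (lt_of_le_of_lt ?_ h3))
      refine (sq_avg_le (hI.1 N) _).trans_eq (avg_congr fun n _ => nm_sq S.pos _)
    refine (nm_avg_le S.pos _ _).trans ?_
    calc avg (I N) (fun n => nm S.τ (S.T 0 (-n) (b N) * X.1 (N, n)))
        ≤ avg (I N) (fun n => D * nm S.τ (X.1 (N, n))) :=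
          avg_le_avg fun n _ => (S.MB_T 0 (-n) (hb N)).2 _
      _ = D * avg (I N) (fun n => nm S.τ (X.1 (N, n))) := (const_mul_avg _ _ _).symm
      _ ≤ (D + 1) * (ε / 2 / (D + 1)) :=
          (mul_le_mul_of_nonneg_left e2 hD0).trans (by gcongr; linarith)
      _ = ε / 2 := by field_simp
  have e : a1 - a2 = ((a1 - b1) - (a2 - b2)) + (b1 - b2) := by ring
  rw [e]
  have t1 := nm_add_le S.pos ((a1 - b1) - (a2 - b2)) (b1 - b2)
  have t2 := nm_sub_le S.pos (a1 - b1) (a2 - b2)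
  linarith

end Sys
end FSJ

namespace FSJ

universe u

/-- Weak limits along ultrafilters exist in Hilbert spaces. -/
theorem exists_weak_lim {H : Type u} [NormedAddCommGroup H] [InnerProductSpace ℝ H]
    [CompleteSpace H] (p : Ultrafilter ℕ) (s : ℕ → H) (C : ℝ) (hs : ∀ n, ‖s n‖ ≤ C) :
    ∃ σ : H, ∀ x, Tendsto (fun n => inner ℝ (s n) x) p (nhds (inner ℝ σ x)) := by
  have hb : ∀ x n, |inner ℝ (s n) x| ≤ C * ‖x‖ := fun x n =>
    (abs_real_inner_le_norm _ _).trans (mul_le_mul_of_nonneg_right (hs n) (norm_nonneg _))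
  have ht : ∀ x, Tendsto (fun n => inner ℝ (s n) x) p
      (nhds (ulim p fun n => inner ℝ (s n) x)) := fun x => tendsto_ulim p (hb x)
  let L : H →ₗ[ℝ] ℝ :=
    { toFun := fun x => ulim p fun n => inner ℝ (s n) x
      map_add' := fun x y => by
        apply ulim_eq
        convert! (ht x).add (ht y) using 2 with n
        rw [inner_add_right]
      map_smul' := fun c x => by
        apply ulim_eq
        convert! (ht x).const_mul c using 2 with n
        rw [inner_smul_right] }
  let L' : StrongDual ℝ H := L.mkContinuous C (fun x => by
    rw [Real.norm_eq_abs]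
    exact le_of_tendsto' (ht x).abs (hb x))
  refine ⟨(InnerProductSpace.toDual ℝ H).symm L', fun x => ?_⟩
  rw [InnerProductSpace.toDual_symm_apply]
  exact ht x

/-- The vectors with Cauchy orbits under an equicontinuous sequence form a closed submodule. -/
theorem cauchy_submodule {H : Type u} [NormedAddCommGroup H] [NormedSpace ℝ H]
    (L : ℕ → H →L[ℝ] H) (C : ℝ) (hL : ∀ n x, ‖L n x‖ ≤ C * ‖x‖) :
    ∃ W : Submodule ℝ H, IsClosed (W : Set H) ∧ ∀ x, x ∈ W ↔ CauchySeq fun n => L n x := by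
  refine ⟨{ carrier := {x | CauchySeq fun n => L n x}
            add_mem' := fun {x y} hx hy => by
              simp only [Set.mem_setOf_eq, map_add] at *
              exact hx.add hy
            zero_mem' := by
              simp only [Set.mem_setOf_eq, map_zero]
              exact cauchySeq_const 0
            smul_mem' := fun c x hx => by
              simp only [Set.mem_setOf_eq, map_smul] at *
              exact (uniformContinuous_const_smul c).comp_cauchySeq hx }, ?_, fun x => Iff.rfl⟩
  refine isClosed_of_closure_subset fun x hx => ?_
  change CauchySeq fun n => L n x
  rw [Metric.cauchySeq_iff']
  intro ε hε
  have hC : 0 < |C| + 1 := by positivity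
  obtain ⟨y, hy, hxy⟩ := Metric.mem_closure_iff.1 hx (ε / 3 / (|C| + 1)) (by positivity)
  obtain ⟨N, hN⟩ := Metric.cauchySeq_iff'.1 hy (ε / 3) (by positivity)
  have key : ∀ n, ‖L n (x - y)‖ < ε / 3 := fun n => by
    rw [dist_eq_norm] at hxy
    calc ‖L n (x - y)‖ ≤ C * ‖x - y‖ := hL _ _
      _ ≤ (|C| + 1) * ‖x - y‖ := by gcongr; linarith [le_abs_self C]
      _ < (|C| + 1) * (ε / 3 / (|C| + 1)) := by gcongr
      _ = ε / 3 := by field_simp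
  refine ⟨N, fun n hn => ?_⟩
  have h1 := key n
  have h2 := key N
  have h3 := hN n hn
  rw [dist_eq_norm] at h3 ⊢
  have e : L n x - L N x = L n (x - y) - L N (x - y) + (L n y - L N y) := by
    simp only [map_sub]; abel
  rw [e]
  have t1 := norm_add_le (L n (x - y) - L N (x - y)) (L n y - L N y)
  have t2 := norm_sub_le (L n (x - y)) (L N (x - y))
  linarith

theorem main_cauchy {G : Type} [AddCommGroup G] [DecidableEq G] (I : ℕ → Finset G)
    (hI : Folner I) (d : ℕ) :
    ∀ (R : Type u) [CommRing R] [Algebra ℝ R] (S : Sys G R d) (f : Fin d → R),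
      ∀ ε > 0, ∃ N0, ∀ M ≥ N0, ∀ M' ≥ N0, nm S.τ (S.A (I M) f - S.A (I M') f) ≤ ε := by
  induction d with
  | zero =>
    intro R _ _ S f ε hε
    refine ⟨0, fun M _ M' _ => ?_⟩
    have : ∀ M, S.A (I M) f = 1 := fun M => by
      simp only [Sys.A, Finset.univ_eq_empty, Finset.prod_empty]
      exact avg_const (hI.1 M) 1
    rw [this, this, sub_self]
    simpa [nm] using hε.le
  | succ d ih =>
    intro R _ _ S f
    obtain ⟨H, i1, i2, i3, ι, hdense, hinner, hnorm⟩ := exists_hilbert_nm S.pos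
    choose C hC using S.exists_MB_P
    have hC0 : ∀ g, 0 ≤ C g := fun g => (hC g 0).1
    have hΦb : ∀ g N x, ‖(ι ∘ₗ S.Φ g (I N)) x‖ ≤ C g * ‖ι x‖ := fun g N x => by
      simp only [LinearMap.comp_apply, hnorm]
      exact S.nm_Φ_le (hC g) (hI.1 N) x
    let L : (Fin d → R) → ℕ → H →L[ℝ] H := fun g N => (ι ∘ₗ S.Φ g (I N)).extendOfNorm ι
    have hLι : ∀ g N x, L g N (ι x) = ι (S.Φ g (I N) x) := fun g N x =>
      LinearMap.extendOfNorm_eq hdense ⟨C g, hΦb g N⟩ x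
    have hLb : ∀ g N x, ‖L g N x‖ ≤ C g * ‖x‖ := fun g N x =>
      LinearMap.norm_extendOfNorm_apply_le hdense (C g) (hΦb g N) x
    choose W hWc hW using fun g => cauchy_submodule (L g) (C g) (hLb g)
    let K : Submodule ℝ H := ⨅ g, W g
    have hKc : IsClosed (K : Set H) := by
      simp only [K, Submodule.coe_iInf]
      exact isClosed_iInter hWc
    -- structured functions belong to `K`
    have hstruct : ∀ (p : Ultrafilter ℕ), (p : Filter ℕ) ≤ atTop → ∀ (f : Fin d → R) (b : ℕ → R)
        (D : ℝ), (∀ N, MB S.τ D (b N)) → ∀ σ : H,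
        (∀ x, Tendsto (fun N => inner ℝ (ι (S.Ψ f (I N) (b N))) x) p (nhds (inner ℝ σ x))) →
        σ ∈ K := by
      intro p hp f b D hb σ hσ
      simp only [K, Submodule.mem_iInf]
      intro g
      rw [hW, Metric.cauchySeq_iff]
      intro ε hε
      obtain ⟨N0, hN0⟩ := S.key I hI ih p hp f g b D hb (ε / 2) (by positivity)
      refine ⟨N0, fun M hM M' hM' => ?_⟩
      have hev := hN0 M hM M' hM'
      let Q : H →L[ℝ] H := L g M - L g M'
      have hQ : ‖Q σ‖ ≤ ε / 2 := by
        have hlim : Tendsto (fun N => inner ℝ (Q (ι (S.Ψ f (I N) (b N)))) (Q σ)) p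
            (nhds (inner ℝ (Q σ) (Q σ))) := by
          have := hσ (ContinuousLinearMap.adjoint Q (Q σ))
          simpa only [ContinuousLinearMap.adjoint_inner_right] using this
        have hle : inner ℝ (Q σ) (Q σ) ≤ ε / 2 * ‖Q σ‖ := by
          refine le_of_tendsto hlim ?_
          filter_upwards [hev] with N hN
          refine (real_inner_le_norm _ _).trans (mul_le_mul_of_nonneg_right ?_ (norm_nonneg _))
          have : Q (ι (S.Ψ f (I N) (b N))) = ι (S.Φ g (I M) (S.Ψ f (I N) (b N)) -
              S.Φ g (I M') (S.Ψ f (I N) (b N))) := by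
            simp only [Q, ContinuousLinearMap.sub_apply, hLι, map_sub]
          rw [this, hnorm]
          exact hN
        rw [real_inner_self_eq_norm_sq] at hle
        by_contra hcon
        push Not at hcon
        nlinarith [norm_nonneg (Q σ)]
      rw [dist_eq_norm]
      have : L g M σ - L g M' σ = Q σ := rfl
      rw [this]
      linarith
    -- orthogonal functions have vanishing averages
    have horth : ∀ (g : Fin d → R) (h : H), h ∈ Kᗮ → Tendsto (fun N => L g N h) atTop (nhds 0) := by
      intro g h hh
      rw [tendsto_zero_iff_norm_tendsto_zero]
      by_contra hcon
      rw [Metric.tendsto_atTop] at hcon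
      push Not at hcon
      obtain ⟨δ, hδ, hfr⟩ := hcon
      have hfreq : ∃ᶠ N in atTop, δ ≤ ‖L g N h‖ := by
        rw [frequently_atTop]
        intro a
        obtain ⟨n, hn, h2⟩ := hfr a
        exact ⟨n, hn, by simpa using h2⟩
      have hne : (atTop ⊓ 𝓟 {N | δ ≤ ‖L g N h‖}).NeBot := Filter.frequently_mem_iff_neBot.1 hfreq
      let p : Ultrafilter ℕ := Ultrafilter.of (atTop ⊓ 𝓟 {N | δ ≤ ‖L g N h‖})
      have hpl : (p : Filter ℕ) ≤ atTop ⊓ 𝓟 {N | δ ≤ ‖L g N h‖} := Ultrafilter.of_le _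
      have hp : (p : Filter ℕ) ≤ atTop := hpl.trans inf_le_left
      have hpδ : ∀ᶠ N in (p : Filter ℕ), δ ≤ ‖L g N h‖ :=
        (hpl.trans inf_le_right) (mem_principal_self _)
      set c := C g with hc
      have hη : 0 < δ ^ 2 / 2 / (c * c * ‖h‖ + 1) := by
        have := hC0 g
        positivity
      obtain ⟨h', hh'⟩ := hdense.exists_dist_lt h hη
      obtain ⟨D, hD⟩ := S.bdd h'
      have hbN : ∀ N, MB S.τ (c * D) (S.Φ g (I N) h') := fun N => S.MB_Φ (hC g) (hI.1 N) hD
      obtain ⟨σ, hσ⟩ := exists_weak_lim p (fun N => ι (S.Ψ g (I N) (S.Φ g (I N) h')))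
        (c * (c * nm S.τ h')) (fun N => by
          rw [hnorm]
          refine (S.nm_Ψ_le (hC g) (hI.1 N) _).trans (mul_le_mul_of_nonneg_left ?_ (hC0 g))
          exact S.nm_Φ_le (hC g) (hI.1 N) h')
      have hσK : σ ∈ K := hstruct p hp g _ _ hbN σ hσ
      have hzero : inner ℝ σ h = 0 := (Submodule.mem_orthogonal _ _).1 hh σ hσK
      have hadj : ∀ N x, inner ℝ (ι (S.Ψ g (I N) (S.Φ g (I N) h'))) x =
          inner ℝ (L g N (ι h')) (L g N x) := by
        intro N x
        refine hdense.induction_on (p := fun x => inner ℝ (ι (S.Ψ g (I N) (S.Φ g (I N) h'))) x =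
          inner ℝ (L g N (ι h')) (L g N x)) x ?_ ?_
        · exact isClosed_eq (by fun_prop) (by fun_prop)
        · intro y
          rw [hLι, hLι, hinner, hinner, S.Ψ_Φ]
      have hge : δ ^ 2 / 2 ≤ inner ℝ σ h := by
        refine ge_of_tendsto (hσ h) ?_
        filter_upwards [hpδ] with N hN
        rw [hadj]
        have e : L g N (ι h') = L g N h - L g N (h - ι h') := by simp
        rw [e, inner_sub_left, real_inner_self_eq_norm_sq]
        have b1 : inner ℝ (L g N (h - ι h')) (L g N h) ≤ δ ^ 2 / 2 := by
          refine (real_inner_le_norm _ _).trans ?_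
          rw [dist_eq_norm] at hh'
          have hc0 : 0 ≤ c := hC0 g
          calc ‖L g N (h - ι h')‖ * ‖L g N h‖
              ≤ (c * (δ ^ 2 / 2 / (c * c * ‖h‖ + 1))) * (c * ‖h‖) := by
                refine mul_le_mul ?_ (hLb g N h) (norm_nonneg _) (by positivity)
                refine (hLb g N _).trans ?_
                gcongr
            _ = (δ ^ 2 / 2) * ((c * c * ‖h‖) / (c * c * ‖h‖ + 1)) := by ring
            _ ≤ (δ ^ 2 / 2) * 1 := by
                gcongr
                rw [div_le_one (by positivity)]
                linarith
            _ = _ := by ring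
        have b2 : δ ^ 2 ≤ ‖L g N h‖ ^ 2 := by gcongr
        linarith
      rw [hzero] at hge
      have : 0 < δ ^ 2 / 2 := by positivity
      linarith
    -- conclusion
    have hcomplete : CompleteSpace K := hKc.completeSpace_coe
    intro ε hε
    set g : Fin d → R := fun i => f i.succ with hg
    obtain ⟨y, hy, z, hz, hyz⟩ := K.exists_add_mem_mem_orthogonal (ι (f 0))
    have hyc : CauchySeq fun n => L g n y := by
      rw [← hW]
      exact (Submodule.mem_iInf _).1 hy g
    have hzc : CauchySeq fun n => L g n z := (horth g z hz).cauchySeq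
    have hsum : CauchySeq fun n => L g n (ι (f 0)) := by
      rw [hyz]
      simp only [map_add]
      exact hyc.add hzc
    obtain ⟨N0, hN0⟩ := Metric.cauchySeq_iff.1 hsum ε hε
    refine ⟨N0, fun M hM M' hM' => ?_⟩
    have := (hN0 M hM M' hM').le
    rw [dist_eq_norm, hLι, hLι, ← map_sub, hnorm] at this
    rwa [S.A_eq_Φ, S.A_eq_Φ]
end FSJ

namespace FSJ

universe u

theorem abs_prod_sub_prod_le {ι : Type*} (s : Finset ι) (a b : ι → ℝ)
    (ha : ∀ i, 0 ≤ a i ∧ a i ≤ 1) (hb : ∀ i, 0 ≤ b i ∧ b i ≤ 1) :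
    |∏ i ∈ s, a i - ∏ i ∈ s, b i| ≤ ∑ i ∈ s, |a i - b i| := by
  classical
  induction s using Finset.induction_on with
  | empty => simp
  | insert j s hj ih =>
    rw [Finset.prod_insert hj, Finset.prod_insert hj, Finset.sum_insert hj]
    have e : a j * ∏ i ∈ s, a i - b j * ∏ i ∈ s, b i =
      (a j - b j) * ∏ i ∈ s, a i + b j * (∏ i ∈ s, a i - ∏ i ∈ s, b i) := by ring
    have h0 : 0 ≤ ∏ i ∈ s, a i := Finset.prod_nonneg fun i _ => (ha i).1
    have h1 : ∏ i ∈ s, a i ≤ 1 := Finset.prod_le_one (fun i _ => (ha i).1) fun i _ => (ha i).2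
    rw [e]
    refine (abs_add_le _ _).trans (add_le_add ?_ ?_)
    · rw [abs_mul, abs_of_nonneg h0]
      exact mul_le_of_le_one_right (abs_nonneg _) h1
    · rw [abs_mul, abs_of_nonneg (hb j).1]
      exact (mul_le_of_le_one_left (abs_nonneg _) (hb j).2).trans ih

theorem exists_cont_approx {X : Type*} [TopologicalSpace X] [PolishSpace X] [MeasurableSpace X]
    [BorelSpace X] (μ : Measure X) [IsProbabilityMeasure μ] (A : Set X) (hA : MeasurableSet A)
    (δ : ℝ) (hδ : 0 < δ) :
    ∃ g : X → ℝ, Continuous g ∧ (∀ x, 0 ≤ g x ∧ g x ≤ 1) ∧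
      ∫ x, |A.indicator (fun _ => (1 : ℝ)) x - g x| ∂μ ≤ δ := by
  letI := TopologicalSpace.upgradeIsCompletelyMetrizable X
  have hi : Integrable (A.indicator (fun _ => (1 : ℝ))) μ :=
    (integrable_const 1).indicator hA
  obtain ⟨g, hg, hgi⟩ := hi.exists_boundedContinuous_integral_sub_le hδ
  refine ⟨fun x => max 0 (min 1 (g x)), by fun_prop, fun x => ⟨by simp, by simp⟩, le_trans ?_ hg⟩
  refine integral_mono_of_nonneg (ae_of_all _ fun x => abs_nonneg _) (hi.sub hgi).norm
    (ae_of_all _ fun x => ?_)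
  have h1 : A.indicator (fun _ => (1 : ℝ)) x =
      max 0 (min 1 (A.indicator (fun _ => (1 : ℝ)) x)) := by
    by_cases hx : x ∈ A <;> simp [hx]
  simp only [Real.norm_eq_abs, Pi.sub_apply]
  conv_lhs => rw [h1]
  have l1 := abs_max_sub_max_le_max 0 (min 1 (A.indicator (fun _ => (1 : ℝ)) x)) 0 (min 1 (g x))
  have l2 := abs_min_sub_min_le_max 1 (A.indicator (fun _ => (1 : ℝ)) x) 1 (g x)
  rw [sub_self, abs_zero] at l1 l2
  exact (l1.trans (max_le (abs_nonneg _) le_rfl)).trans (l2.trans (max_le (abs_nonneg _) le_rfl))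

theorem indicator_pi_eq {X : Type*} {d : ℕ} (A : Fin d → Set X) (y : Fin d → X) :
    (Set.univ.pi A).indicator (fun _ => (1 : ℝ)) y =
      ∏ i, (A i).indicator (fun _ => (1 : ℝ)) (y i) := by
  classical
  by_cases h : ∀ i, y i ∈ A i
  · rw [Set.indicator_of_mem (by simpa using h)]
    exact (Finset.prod_eq_one fun i _ => Set.indicator_of_mem (h i) _).symm
  · push Not at h
    obtain ⟨i, hi⟩ := h
    rw [Set.indicator_of_notMem (by simpa using ⟨i, hi⟩)]
    exact (Finset.prod_eq_zero (Finset.mem_univ i) (Set.indicator_of_notMem hi _)).symm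

theorem approx_rect {X : Type*} [MeasurableSpace X] {d : ℕ} (μ : Measure X)
    (ν : Measure (Fin d → X)) [IsProbabilityMeasure ν]
    (hν : ∀ i, ν.map (fun y => y i) = μ) (A : Fin d → Set X) (hA : ∀ i, MeasurableSet (A i))
    (g : Fin d → X → ℝ) (hgm : ∀ i, Measurable (g i)) (hg : ∀ i x, 0 ≤ g i x ∧ g i x ≤ 1) (δ : ℝ)
    (h : ∀ i, ∫ x, |(A i).indicator (fun _ => (1 : ℝ)) x - g i x| ∂μ ≤ δ) :
    |ν.real (Set.univ.pi A) - ∫ y, ∏ i, g i (y i) ∂ν| ≤ d * δ := by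
  have hrm : MeasurableSet (Set.univ.pi A) := MeasurableSet.univ_pi hA
  have hind : ∀ i x, 0 ≤ (A i).indicator (fun _ => (1 : ℝ)) x ∧
      (A i).indicator (fun _ => (1 : ℝ)) x ≤ 1 := by
    intro i x
    by_cases hx : x ∈ A i <;> simp [hx]
  have hm : ∀ i, Measurable ((A i).indicator (fun _ => (1 : ℝ))) := fun i =>
    measurable_const.indicator (hA i)
  have i1 : Integrable (fun y : Fin d → X => ∏ i, g i (y i)) ν := by
    refine Integrable.of_bound (C := 1) ?_ (ae_of_all _ fun y => ?_)
    · exact (Finset.measurable_prod _ fun i _ =>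
        (hgm i).comp (measurable_pi_apply i)).aestronglyMeasurable
    · rw [Real.norm_eq_abs, abs_of_nonneg (Finset.prod_nonneg fun i _ => (hg i _).1)]
      exact Finset.prod_le_one (fun i _ => (hg i _).1) fun i _ => (hg i _).2
  have i2 : Integrable (fun y : Fin d → X => (Set.univ.pi A).indicator (fun _ => (1 : ℝ)) y) ν :=
    (integrable_const 1).indicator hrm
  have mi : ∀ i, Measurable (fun x => |(A i).indicator (fun _ => (1 : ℝ)) x - g i x|) := fun i =>
    ((hm i).sub (hgm i)).abs
  have i3 : ∀ i, Integrable (fun y : Fin d → X =>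
      |(A i).indicator (fun _ => (1 : ℝ)) (y i) - g i (y i)|) ν := by
    intro i
    refine Integrable.of_bound (C := 1) ?_ (ae_of_all _ fun y => ?_)
    · exact ((mi i).comp (measurable_pi_apply i)).aestronglyMeasurable
    · rw [Real.norm_eq_abs, abs_abs, abs_le]
      have a1 := hind i (y i)
      have a2 := hg i (y i)
      constructor <;> linarith
  have e1 : ν.real (Set.univ.pi A) =
      ∫ y, (Set.univ.pi A).indicator (fun _ => (1 : ℝ)) y ∂ν := by
    rw [integral_indicator hrm]; simp
  rw [e1, ← integral_sub i2 i1]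
  refine abs_integral_le_integral_abs.trans ?_
  calc ∫ y, |(Set.univ.pi A).indicator (fun _ => (1 : ℝ)) y - ∏ i, g i (y i)| ∂ν
      ≤ ∫ y, ∑ i, |(A i).indicator (fun _ => (1 : ℝ)) (y i) - g i (y i)| ∂ν := by
        refine integral_mono (i2.sub i1).abs (integrable_finsetSum _ fun i _ => i3 i) fun y => ?_
        simp only [indicator_pi_eq]
        exact abs_prod_sub_prod_le _ _ _ (fun i => hind i _) fun i => hg i _
    _ = ∑ i, ∫ y, |(A i).indicator (fun _ => (1 : ℝ)) (y i) - g i (y i)| ∂ν :=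
        integral_finsetSum _ fun i _ => i3 i
    _ ≤ ∑ _i : Fin d, δ := by
        refine Finset.sum_le_sum fun i _ => ?_
        refine le_trans (le_of_eq ?_) (h i)
        rw [← hν i, integral_map (measurable_pi_apply i).aemeasurable
          (mi i).aestronglyMeasurable]
    _ = d * δ := by simp

theorem exists_limit_measure {X : Type*} [MeasurableSpace X] [StandardBorelSpace X]
    (μ : Measure X) [IsProbabilityMeasure μ] {d : ℕ} (ν : ℕ → Measure (Fin d → X))
    [hprob : ∀ N, IsProbabilityMeasure (ν N)] (hν : ∀ N i, (ν N).map (fun y => y i) = μ)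
    (hlim : ∀ A : Fin d → Set X, (∀ i, MeasurableSet (A i)) →
      ∃ l, Tendsto (fun N => (ν N).real (Set.univ.pi A)) atTop (nhds l)) :
    ∃ ν' : Measure (Fin d → X), IsProbabilityMeasure ν' ∧
      ∀ A : Fin d → Set X, (∀ i, MeasurableSet (A i)) →
        Tendsto (fun N => (ν N).real (Set.univ.pi A)) atTop (nhds (ν'.real (Set.univ.pi A))) := by
  letI := upgradeStandardBorel X
  let P : ℕ → ProbabilityMeasure (Fin d → X) := fun N => ⟨ν N, hprob N⟩
  have htight : IsTightMeasureSet {((m : ProbabilityMeasure (Fin d → X)) : Measure (Fin d → X)) |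
      m ∈ Set.range P} := by
    rw [isTightMeasureSet_iff_exists_isCompact_measure_compl_le]
    intro ε hε
    have ht : IsTightMeasureSet {μ} := isTightMeasureSet_singleton
    rw [isTightMeasureSet_iff_exists_isCompact_measure_compl_le] at ht
    obtain ⟨K, hK, hKμ⟩ := ht (ε / (d + 1)) (ENNReal.div_pos hε.ne' (by simp))
    have hKμ := hKμ μ rfl
    refine ⟨Set.univ.pi fun _ => K, isCompact_univ_pi fun _ => hK, ?_⟩
    rintro _ ⟨_, ⟨N, rfl⟩, rfl⟩
    change ν N _ ≤ ε
    have hsub : (Set.univ.pi fun _ : Fin d => K)ᶜ ⊆ ⋃ i : Fin d, (fun y => y i) ⁻¹' Kᶜ := by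
      intro y hy
      simp only [Set.mem_compl_iff, Set.mem_pi, Set.mem_univ, true_imp_iff, not_forall] at hy
      simpa using hy
    refine (measure_mono hsub).trans ((measure_iUnion_fintype_le _ _).trans ?_)
    have : ∀ i, ν N ((fun y : Fin d → X => y i) ⁻¹' Kᶜ) ≤ ε / (d + 1) := fun i => by
      rw [← Measure.map_apply (measurable_pi_apply i) hK.measurableSet.compl, hν]
      exact hKμ
    refine (Finset.sum_le_sum fun i _ => this i).trans ?_
    simp only [sum_const, card_univ, Fintype.card_fin, nsmul_eq_mul]
    calc (d : ℝ≥0∞) * (ε / (d + 1)) ≤ (d + 1) * (ε / (d + 1)) := by gcongr; simp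
      _ ≤ ε := ENNReal.mul_div_le
  have hcomp := isCompact_closure_of_isTightMeasureSet htight
  let p : Ultrafilter ℕ := Filter.hyperfilter ℕ
  have hp : (p : Filter ℕ) ≤ atTop := by
    rw [← Nat.cofinite_eq_atTop]; exact Filter.hyperfilter_le_cofinite
  obtain ⟨Q, _, hQ⟩ := hcomp.ultrafilter_le_nhds (p.map P) (le_principal_iff.2
    (show P ⁻¹' (closure (Set.range P)) ∈ (p : Filter ℕ) from
      Filter.univ_mem' fun n => subset_closure ⟨n, rfl⟩))
  have hQ : Tendsto P p (nhds Q) := hQ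
  rw [ProbabilityMeasure.tendsto_iff_forall_integral_tendsto] at hQ
  have hQm : ∀ i, (Q : Measure (Fin d → X)).map (fun y => y i) = μ := by
    intro i
    have : IsProbabilityMeasure ((Q : Measure (Fin d → X)).map (fun y => y i)) :=
      Measure.isProbabilityMeasure_map (measurable_pi_apply i).aemeasurable
    refine ext_of_forall_integral_eq_of_IsFiniteMeasure fun f => ?_
    have h1 := hQ (f.compContinuous ⟨fun y => y i, continuous_apply i⟩)
    have h2 : ∀ m : Measure (Fin d → X), ∫ y, f (y i) ∂m = ∫ x, f x ∂(m.map fun y => y i) :=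
      fun m => (integral_map (measurable_pi_apply i).aemeasurable
        f.continuous.measurable.aestronglyMeasurable).symm
    simp only [BoundedContinuousFunction.compContinuous_apply, ContinuousMap.coe_mk, h2] at h1
    have h3 : ∀ N, (P N : Measure (Fin d → X)).map (fun y => y i) = μ := fun N => hν N i
    simp only [h3] at h1
    exact tendsto_nhds_unique h1 tendsto_const_nhds
  refine ⟨Q, inferInstance, fun A hA => ?_⟩
  obtain ⟨l, hl⟩ := hlim A hA
  suffices h : l = (Q : Measure (Fin d → X)).real (Set.univ.pi A) by rwa [← h]
  rw [← sub_eq_zero, ← abs_nonpos_iff]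
  refine le_of_forall_pos_le_add fun ε hε => ?_
  have hδ : 0 < ε / (2 * d + 1) := by positivity
  choose g hgc hg01 hgi using fun i => exists_cont_approx μ (A i) (hA i) (ε / (2 * d + 1)) hδ
  let F : BoundedContinuousFunction (Fin d → X) ℝ :=
    BoundedContinuousFunction.ofNormedAddCommGroup (fun y => ∏ i, g i (y i)) (by fun_prop) 1
      (fun y => by
        rw [Real.norm_eq_abs, abs_of_nonneg (Finset.prod_nonneg fun i _ => (hg01 i _).1)]
        exact Finset.prod_le_one (fun i _ => (hg01 i _).1) fun i _ => (hg01 i _).2)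
  have hF : Tendsto (fun N => ∫ y, ∏ i, g i (y i) ∂(ν N)) p
    (nhds (∫ y, ∏ i, g i (y i) ∂(Q : Measure (Fin d → X)))) := hQ F
  have b1 := approx_rect μ (Q : Measure (Fin d → X)) hQm A hA g (fun i => (hgc i).measurable) hg01 _ hgi
  have b2 : |l - ∫ y, ∏ i, g i (y i) ∂(Q : Measure (Fin d → X))| ≤ d * (ε / (2 * d + 1)) :=
    le_of_tendsto' ((hl.mono_left hp).sub hF).abs fun N =>
      approx_rect μ (ν N) (hν N) A hA g (fun i => (hgc i).measurable) hg01 _ hgi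
  have b3 : 2 * d * (ε / (2 * d + 1)) ≤ ε := by
    rw [← mul_div_assoc, div_le_iff₀ (by positivity)]
    nlinarith
  rw [abs_le] at *
  constructor <;> linarith [b1.1, b1.2, b2.1, b2.2]
end FSJ

namespace FSJ

universe u

/-- Bounded measurable functions. -/
def BM (X : Type u) [MeasurableSpace X] : Subalgebra ℝ (X → ℝ) where
  carrier := {f | Measurable f ∧ ∃ C, ∀ x, |f x| ≤ C}
  mul_mem' := by
    rintro f g ⟨hf, C, hC⟩ ⟨hg, D, hD⟩
    refine ⟨hf.mul hg, C * D, fun x => ?_⟩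
    rw [Pi.mul_apply, abs_mul]
    exact mul_le_mul (hC x) (hD x) (abs_nonneg _) ((abs_nonneg _).trans (hC x))
  add_mem' := by
    rintro f g ⟨hf, C, hC⟩ ⟨hg, D, hD⟩
    exact ⟨hf.add hg, C + D, fun x => (abs_add_le _ _).trans (add_le_add (hC x) (hD x))⟩
  algebraMap_mem' := fun c => ⟨measurable_const, |c|, fun x => le_rfl⟩

theorem BM.integrable {X : Type u} [MeasurableSpace X] (μ : Measure X) [IsProbabilityMeasure μ]
    (f : BM X) : Integrable (f : X → ℝ) μ := by
  obtain ⟨hf, C, hC⟩ := f.2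
  exact Integrable.of_bound hf.aestronglyMeasurable C (ae_of_all _ hC)

/-- Integration as a functional. -/
noncomputable def tauBM {X : Type u} [MeasurableSpace X] (μ : Measure X) [IsProbabilityMeasure μ] :
    BM X →ₗ[ℝ] ℝ where
  toFun f := ∫ x, (f : X → ℝ) x ∂μ
  map_add' f g := integral_add (BM.integrable μ f) (BM.integrable μ g)
  map_smul' c _ := integral_const_mul c _

/-- Composition with a measurable map. -/
def compBM {X : Type u} [MeasurableSpace X] (t : X → X) (ht : Measurable t) : BM X →ₐ[ℝ] BM X where
  toFun f := ⟨fun x => (f : X → ℝ) (t x), f.2.1.comp ht, f.2.2.imp fun _ hC x => hC (t x)⟩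
  map_one' := rfl
  map_mul' _ _ := rfl
  map_zero' := rfl
  map_add' _ _ := rfl
  commutes' _ := rfl

theorem exists_sys {X : Type u} [MeasurableSpace X]
    (μ : Measure X) [IsProbabilityMeasure μ] {r d : ℕ}
    (T : Fin d → (Fin r → ℤ) → X → X)
    (hmp : ∀ i n, MeasurePreserving (T i n) μ μ)
    (hid : ∀ i x, T i 0 x = x)
    (hadd : ∀ i n m x, T i (n + m) x = T i n (T i m x))
    (hcomm : ∀ i j n m x, T i n (T j m x) = T j m (T i n x)) :
    ∃ S : Sys (Fin r → ℤ) (BM X) d, S.τ = tauBM μ ∧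
      ∀ i n, S.T i n = compBM (T i n) (hmp i n).measurable := by
  have hpos : ∀ f : BM X, 0 ≤ tauBM μ (f * f) := fun f =>
    integral_nonneg fun x => mul_self_nonneg ((f : X → ℝ) x)
  refine ⟨⟨tauBM μ, hpos, ?_, fun i n => compBM (T i n) (hmp i n).measurable,
    ?_, ?_, ?_, ?_⟩, rfl, fun _ _ => rfl⟩
  · rintro f
    obtain ⟨hf, C, hC⟩ := f.2
    refine ⟨|C|, abs_nonneg _, fun h => ?_⟩
    rw [nm, nm, ← Real.sqrt_sq (abs_nonneg C), ← Real.sqrt_mul (sq_nonneg _)]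
    apply Real.sqrt_le_sqrt
    rw [← smul_eq_mul (|C| ^ 2), ← map_smul]
    refine integral_mono (BM.integrable μ _) (BM.integrable μ _) fun x => ?_
    change ((f : X → ℝ) x * (h : X → ℝ) x) * ((f : X → ℝ) x * (h : X → ℝ) x) ≤
      |C| ^ 2 * ((h : X → ℝ) x * (h : X → ℝ) x)
    have h1 : (f : X → ℝ) x ^ 2 ≤ |C| ^ 2 := by
      rw [← sq_abs]
      exact pow_le_pow_left₀ (abs_nonneg _) ((hC x).trans (le_abs_self _)) 2
    nlinarith [mul_le_mul_of_nonneg_right h1 (mul_self_nonneg ((h : X → ℝ) x))]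
  · intro i f
    ext x
    exact congrArg (f : X → ℝ) (hid i x)
  · intro i m n f
    ext x
    refine congrArg (f : X → ℝ) ?_
    rw [add_comm, hadd]
  · intro i j m n f
    ext x
    exact congrArg (f : X → ℝ) (hcomm j i n m x)
  · intro i n f
    change ∫ x, (f : X → ℝ) (T i n x) ∂μ = ∫ x, (f : X → ℝ) x ∂μ
    have h := integral_map (μ := μ) (hmp i n).measurable.aemeasurable
      (f := (f : X → ℝ)) f.2.1.aestronglyMeasurable
    rw [(hmp i n).map_eq] at h
    exact h.symm

theorem scalar_conv {X : Type u} [MeasurableSpace X]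
    (μ : Measure X) [IsProbabilityMeasure μ] {r d : ℕ}
    (T : Fin d → (Fin r → ℤ) → X → X)
    (hmp : ∀ i n, MeasurePreserving (T i n) μ μ)
    (hid : ∀ i x, T i 0 x = x)
    (hadd : ∀ i n m x, T i (n + m) x = T i n (T i m x))
    (hcomm : ∀ i j n m x, T i n (T j m x) = T j m (T i n x))
    (A : Fin d → Set X) (hA : ∀ i, MeasurableSet (A i))
    (I : ℕ → Finset (Fin r → ℤ)) (hI : Folner I) :
    ∃ l, Tendsto (fun N => ((I N).card : ℝ)⁻¹ *
      ∑ n ∈ I N, ∫ x, ∏ i, (A i).indicator (fun _ => (1:ℝ)) (T i n x) ∂μ) atTop (nhds l) := by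
  obtain ⟨S, hτ, hT⟩ := exists_sys μ T hmp hid hadd hcomm
  let f : Fin d → BM X := fun i => ⟨(A i).indicator (fun _ => (1:ℝ)),
    measurable_const.indicator (hA i), 1, fun x => by
      by_cases hx : x ∈ A i <;> simp [hx]⟩
  have key : ∀ J : Finset (Fin r → ℤ), S.τ (S.A J f) = (J.card : ℝ)⁻¹ *
      ∑ n ∈ J, ∫ x, ∏ i, (A i).indicator (fun _ => (1:ℝ)) (T i n x) ∂μ := by
    intro J
    rw [Sys.A, avg, map_smul, map_sum, smul_eq_mul]
    congr 1
    refine Finset.sum_congr rfl fun n _ => ?_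
    rw [hτ]
    change ∫ x, ((∏ i, S.T i n (f i) : BM X) : X → ℝ) x ∂μ = _
    congr 1
    ext x
    have hprod : ((∏ i, S.T i n (f i) : BM X) : X → ℝ) = ∏ i, ((S.T i n (f i) : BM X) : X → ℝ) :=
      map_prod (BM X).val _ _
    rw [hprod, Finset.prod_apply]
    refine Finset.prod_congr rfl fun i _ => ?_
    rw [hT]
    rfl
  simp_rw [← key]
  apply cauchySeq_tendsto_of_complete
  rw [Metric.cauchySeq_iff]
  intro ε hε
  have h0 : 0 ≤ nm S.τ 1 := nm_nonneg _
  obtain ⟨N0, hN⟩ := main_cauchy I hI d (BM X) S f (ε / (2 * (nm S.τ 1 + 1))) (by positivity)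
  refine ⟨N0, fun m hm n hn => ?_⟩
  rw [Real.dist_eq, ← map_sub]
  refine (abs_tau_le S.pos _).trans_lt ?_
  refine (mul_le_mul_of_nonneg_right (hN m hm n hn) h0).trans_lt ?_
  rw [div_mul_eq_mul_div, div_lt_iff₀ (by positivity)]
  nlinarith

theorem folner_interlace {G : Type} [AddCommGroup G] [DecidableEq G] {I J : ℕ → Finset G}
    (hI : Folner I) (hJ : Folner J) :
    Folner (fun N => if Even N then I (N / 2) else J (N / 2)) := by
  have h2 : Tendsto (fun N : ℕ => N / 2) atTop atTop :=
    tendsto_atTop_atTop.2 fun b => ⟨2 * b, fun a ha => by omega⟩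
  refine ⟨fun N => ?_, fun v => ?_⟩
  · dsimp only
    split_ifs
    exacts [hI.1 _, hJ.1 _]
  · have := (((hI.2 v).comp h2).if' (p := fun N => Even N) ((hJ.2 v).comp h2))
    refine this.congr fun N => ?_
    by_cases h : Even N <;> simp [h]

theorem common_limit {G : Type} [AddCommGroup G] [DecidableEq G] (F : Finset G → ℝ)
    (h : ∀ I : ℕ → Finset G, Folner I → ∃ l, Tendsto (fun N => F (I N)) atTop (nhds l))
    {I J : ℕ → Finset G} (hI : Folner I) (hJ : Folner J) {l : ℝ}
    (hl : Tendsto (fun N => F (I N)) atTop (nhds l)) :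
    Tendsto (fun N => F (J N)) atTop (nhds l) := by
  obtain ⟨l', hl'⟩ := h _ (folner_interlace hI hJ)
  have e0 : Tendsto (fun N : ℕ => 2 * N) atTop atTop :=
    tendsto_atTop_atTop.2 fun b => ⟨b, fun a ha => by omega⟩
  have e1 : Tendsto (fun N : ℕ => 2 * N + 1) atTop atTop :=
    tendsto_atTop_atTop.2 fun b => ⟨b, fun a ha => by omega⟩
  have t0 : Tendsto (fun N => F (I N)) atTop (nhds l') := by
    refine (hl'.comp e0).congr fun N => ?_
    simp
  have t1 : Tendsto (fun N => F (J N)) atTop (nhds l') := by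
    refine (hl'.comp e1).congr fun N => ?_
    have h1 : ¬ Even (2 * N + 1) := by simp
    have h2 : (2 * N + 1) / 2 = N := by omega
    simp only [Function.comp, if_neg h1, h2]
  rwa [tendsto_nhds_unique hl t0]

theorem folner_shift {G : Type} [AddCommGroup G] [DecidableEq G] {I : ℕ → Finset G}
    (hI : Folner I) (a : ℕ → G) : Folner (fun N => (I N).image (· + a N)) := by
  refine ⟨fun N => (hI.1 N).image _, fun v => ?_⟩
  refine (hI.2 v).congr fun N => ?_
  have hinj : Function.Injective (· + a N) := add_left_injective (a N)
  have h1 : (((I N).image (· + a N)).image (· + v)) = ((I N).image (· + v)).image (· + a N) := by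
    rw [Finset.image_image, Finset.image_image]
    congr 1
    ext x
    simp [add_right_comm]
  rw [h1, ← Finset.image_symmDiff _ _ hinj, Finset.card_image_of_injective _ hinj,
    Finset.card_image_of_injective _ hinj]

theorem exists_folner (r : ℕ) : ∃ I : ℕ → Finset (Fin r → ℤ), Folner I := by
  refine ⟨fun N => Fintype.piFinset fun _ => Finset.Ico 0 ((N : ℤ) + 1), fun N => ⟨0, ?_⟩,
    fun v => ?_⟩
  · simp only [Fintype.mem_piFinset, Finset.mem_Ico, Pi.zero_apply]
    intro _
    omega
  set I : ℕ → Finset (Fin r → ℤ) := fun N => Fintype.piFinset fun _ => Finset.Ico 0 ((N : ℤ) + 1)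
    with hIdef
  let K : ℕ → Finset (Fin r → ℤ) := fun N =>
    Fintype.piFinset fun i => Finset.Ico |v i| ((N : ℤ) + 1 - |v i|)
  have cI : ∀ N, ((I N).card : ℝ) = ∏ _i : Fin r, ((N : ℝ) + 1) := by
    intro N
    rw [hIdef, Fintype.card_piFinset]
    push_cast
    refine Finset.prod_congr rfl fun i _ => ?_
    rw [Int.card_Ico]
    have : ((N : ℤ) + 1 - 0).toNat = N + 1 := by omega
    rw [this]
    push_cast
    rfl
  have cK : ∀ N, ((K N).card : ℝ) = ∏ i : Fin r, (((N : ℤ) + 1 - |v i| - |v i|).toNat : ℝ) := by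
    intro N
    rw [Fintype.card_piFinset]
    push_cast
    refine Finset.prod_congr rfl fun i _ => ?_
    rw [Int.card_Ico]
  have hK : ∀ N, K N ⊆ I N ∩ (I N).image (· + v) := by
    intro N x hx
    rw [Fintype.mem_piFinset] at hx
    have hx' : ∀ i, |v i| ≤ x i ∧ x i < (N : ℤ) + 1 - |v i| := fun i => Finset.mem_Ico.1 (hx i)
    rw [Finset.mem_inter, Finset.mem_image]
    refine ⟨Fintype.mem_piFinset.2 fun i => Finset.mem_Ico.2 ?_, x - v,
      Fintype.mem_piFinset.2 fun i => Finset.mem_Ico.2 ?_, sub_add_cancel _ _⟩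
    · have := hx' i
      have := abs_nonneg (v i)
      constructor <;> linarith
    · have := hx' i
      have := neg_abs_le (v i)
      have := le_abs_self (v i)
      rw [Pi.sub_apply]
      constructor <;> linarith
  have hpos : ∀ N, (0 : ℝ) < (I N).card := by
    intro N
    rw [cI]
    positivity
  have hq : Tendsto (fun N => ((K N).card : ℝ) / (I N).card) atTop (nhds 1) := by
    have : Tendsto (fun N : ℕ => ∏ i : Fin r, ((((N : ℤ) + 1 - |v i| - |v i|).toNat : ℝ) /
        ((N : ℝ) + 1))) atTop (nhds (∏ _i : Fin r, (1 : ℝ))) := by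
      refine tendsto_finsetProd _ fun i _ => ?_
      have h0 : Tendsto (fun N : ℕ => 1 - (2 * |(v i : ℝ)|) * (1 / ((N : ℝ) + 1))) atTop
          (nhds (1 - (2 * |(v i : ℝ)|) * 0)) :=
        tendsto_const_nhds.sub (tendsto_one_div_add_atTop_nhds_zero_nat.const_mul _)
      rw [mul_zero, sub_zero] at h0
      refine h0.congr' ?_
      filter_upwards [eventually_ge_atTop (2 * (v i).natAbs)] with N hN
      have h1 : ((((N : ℤ) + 1 - |v i| - |v i|).toNat : ℤ)) = (N : ℤ) + 1 - |v i| - |v i| := by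
        rw [Int.toNat_of_nonneg]
        rw [Int.abs_eq_natAbs]
        omega
      have h2 : ((((N : ℤ) + 1 - |v i| - |v i|).toNat : ℝ)) = (N : ℝ) + 1 - |(v i : ℝ)| - |(v i : ℝ)| := by
        have := congrArg (fun z : ℤ => (z : ℝ)) h1
        push_cast at this
        exact_mod_cast this
      rw [h2]
      field_simp
      ring
    rw [Finset.prod_const_one] at this
    refine this.congr fun N => ?_
    rw [Finset.prod_div_distrib, cI, cK]
  have hub : Tendsto (fun N => 2 * (1 - ((K N).card : ℝ) / (I N).card)) atTop (nhds 0) := by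
    simpa using (tendsto_const_nhds (x := (1 : ℝ)).sub hq).const_mul 2
  refine squeeze_zero (fun N => by positivity) (fun N => ?_) hub
  rw [div_le_iff₀ (hpos N), mul_assoc, sub_mul, one_mul, div_mul_cancel₀ _ (hpos N).ne']
  have hcI : ((I N).image (· + v)).card = (I N).card :=
    Finset.card_image_of_injective _ (add_left_injective v)
  have hle : (((I N).image (· + v)) ∆ (I N)).card ≤
      (((I N).image (· + v)) \ (I N)).card + ((I N) \ ((I N).image (· + v))).card := by
    rw [symmDiff_def]
    exact Finset.card_union_le _ _
  have e1 := Finset.card_sdiff_add_card_inter ((I N).image (· + v)) (I N)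
  have e2 := Finset.card_sdiff_add_card_inter (I N) ((I N).image (· + v))
  have e3 := Finset.card_le_card (hK N)
  rw [Finset.inter_comm] at e1
  have : (((I N).image (· + v)) ∆ (I N)).card + 2 * (K N).card ≤ 2 * (I N).card := by omega
  have : (((((I N).image (· + v)) ∆ (I N)).card : ℝ)) + 2 * (K N).card ≤ 2 * (I N).card := by
    exact_mod_cast this
  linarith

theorem exists_emp {X : Type u} [MeasurableSpace X]
    (μ : Measure X) [IsProbabilityMeasure μ] {r d : ℕ}
    (T : Fin d → (Fin r → ℤ) → X → X)
    (hmp : ∀ i n, MeasurePreserving (T i n) μ μ) (J : Finset (Fin r → ℤ)) (hJ : J.Nonempty) :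
    ∃ ν : Measure (Fin d → X), IsProbabilityMeasure ν ∧ (∀ i, ν.map (fun y => y i) = μ) ∧
      ∀ A : Fin d → Set X, (∀ i, MeasurableSet (A i)) →
        ν.real (Set.univ.pi A) = (J.card : ℝ)⁻¹ *
          ∑ n ∈ J, ∫ x, ∏ i, (A i).indicator (fun _ => (1:ℝ)) (T i n x) ∂μ := by
  have hm : ∀ n, Measurable (fun x (i : Fin d) => T i n x) := fun n =>
    measurable_pi_lambda _ fun i => (hmp i n).measurable
  have hc0 : (J.card : ℝ≥0∞) ≠ 0 := by
    exact_mod_cast hJ.card_pos.ne'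
  have hct : (J.card : ℝ≥0∞) ≠ ⊤ := ENNReal.natCast_ne_top _
  let ν : Measure (Fin d → X) := (J.card : ℝ≥0∞)⁻¹ • ∑ n ∈ J, μ.map (fun x i => T i n x)
  have hν : ∀ s, MeasurableSet s → ν s =
      (J.card : ℝ≥0∞)⁻¹ * ∑ n ∈ J, μ ((fun x i => T i n x) ⁻¹' s) := by
    intro s hs
    rw [Measure.smul_apply, Measure.finsetSum_apply, smul_eq_mul]
    congr 1
    exact Finset.sum_congr rfl fun n _ => Measure.map_apply (hm n) hs
  refine ⟨ν, ⟨?_⟩, fun i => ?_, fun A hA => ?_⟩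
  · rw [hν _ MeasurableSet.univ]
    simp [ENNReal.inv_mul_cancel hc0 hct]
  · ext s hs
    rw [Measure.map_apply (measurable_pi_apply i) hs, hν _ (measurable_pi_apply i hs)]
    have : ∀ n ∈ J, μ ((fun x i => T i n x) ⁻¹' ((fun y : Fin d → X => y i) ⁻¹' s)) = μ s :=
      fun n _ => (hmp i n).measure_preimage hs.nullMeasurableSet
    rw [Finset.sum_congr rfl this, Finset.sum_const, nsmul_eq_mul, ← mul_assoc,
      ENNReal.inv_mul_cancel hc0 hct, one_mul]
  · have hs : MeasurableSet (Set.univ.pi A) := MeasurableSet.univ_pi hA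
    rw [Measure.real, hν _ hs, ENNReal.toReal_mul, ENNReal.toReal_inv, ENNReal.toReal_natCast,
      ENNReal.toReal_sum fun n _ => measure_ne_top _ _]
    congr 1
    refine Finset.sum_congr rfl fun n _ => ?_
    simp_rw [← indicator_pi_eq A (fun i => T i n _)]
    have := integral_indicator_one (μ := μ) (hm n hs)
    rw [Measure.real] at this
    rw [← this]
    rfl

theorem main_result {X : Type u} [MeasurableSpace X] [StandardBorelSpace X]
    (μ : Measure X) [IsProbabilityMeasure μ] (r d : ℕ)
    (T : Fin d → (Fin r → ℤ) → X → X)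
    (hmp : ∀ i n, MeasurePreserving (T i n) μ μ)
    (hid : ∀ i x, T i 0 x = x)
    (hadd : ∀ i n m x, T i (n + m) x = T i n (T i m x))
    (hcomm : ∀ i j n m x, T i n (T j m x) = T j m (T i n x)) :
    ∃! ν : Measure (Fin d → X), IsProbabilityMeasure ν ∧
      ∀ A : Fin d → Set X, (∀ i, MeasurableSet (A i)) →
        ∀ (I : ℕ → Finset (Fin r → ℤ)) (a : ℕ → Fin r → ℤ),
          (∀ N, (I N).Nonempty) →
          (∀ v : Fin r → ℤ, Tendsto
            (fun N => ((((I N).image (· + v)) ∆ (I N)).card : ℝ) / ((I N).card : ℝ))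
            atTop (nhds 0)) →
          Tendsto (fun N => ((I N).card : ℝ)⁻¹ *
              ∑ n ∈ I N, ∫ x, ∏ i, (A i).indicator (fun _ => (1:ℝ)) (T i (n + a N) x) ∂μ)
            atTop (nhds (ν (Set.univ.pi A)).toReal) := by
  obtain ⟨I0, hI0⟩ := exists_folner r
  let F : (Fin d → Set X) → Finset (Fin r → ℤ) → ℝ := fun A J => (J.card : ℝ)⁻¹ *
    ∑ n ∈ J, ∫ x, ∏ i, (A i).indicator (fun _ => (1:ℝ)) (T i n x) ∂μ
  have hF : ∀ A : Fin d → Set X, (∀ i, MeasurableSet (A i)) → ∀ I : ℕ → Finset (Fin r → ℤ),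
      Folner I → ∃ l, Tendsto (fun N => F A (I N)) atTop (nhds l) := fun A hA I hI =>
    scalar_conv μ T hmp hid hadd hcomm A hA I hI
  choose ν hν1 hν2 hν3 using fun N => exists_emp μ T hmp (I0 N) (hI0.1 N)
  obtain ⟨ν', hp, hν'⟩ := exists_limit_measure μ ν hν2 fun A hA => by
    obtain ⟨l, hl⟩ := hF A hA I0 hI0
    exact ⟨l, hl.congr fun N => (hν3 N A hA).symm⟩
  refine ⟨ν', ⟨hp, fun A hA I a h1 h2 => ?_⟩, ?_⟩
  · have hI : Folner I := ⟨h1, h2⟩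
    have t0 : Tendsto (fun N => F A (I0 N)) atTop (nhds (ν'.real (Set.univ.pi A))) :=
      (hν' A hA).congr fun N => hν3 N A hA
    have := common_limit (F A) (hF A hA) hI0 (folner_shift hI a) t0
    refine this.congr fun N => ?_
    have hinj : Function.Injective (· + a N) := add_left_injective (a N)
    simp only [F]
    rw [Finset.card_image_of_injective _ hinj, Finset.sum_image fun x _ y _ h => hinj h]
  · rintro ρ ⟨hρ, hρ'⟩
    have hr : ∀ A : Fin d → Set X, (∀ i, MeasurableSet (A i)) →
        ρ (Set.univ.pi A) = ν' (Set.univ.pi A) := by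
      intro A hA
      have t1 := hρ' A hA I0 0 hI0.1 hI0.2
      have t0 : Tendsto (fun N => F A (I0 N)) atTop (nhds (ν'.real (Set.univ.pi A))) :=
        (hν' A hA).congr fun N => hν3 N A hA
      simp only [Pi.zero_apply, add_zero] at t1
      have := tendsto_nhds_unique t1 t0
      exact (ENNReal.toReal_eq_toReal_iff' (measure_ne_top _ _) (measure_ne_top _ _)).1 this
    refine ext_of_generate_finite _ generateFrom_pi.symm isPiSystem_pi ?_ (by simp)
    rintro s ⟨A, hA, rfl⟩
    exact hr A fun i => hA i (Set.mem_univ i)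
end FSJ

/-- Existence and uniqueness of the Furstenberg self-joining.  Let `T 0, …, T (d-1)`
be commuting measure-preserving `ℤ^r`-actions on a standard Borel probability space,
and assume the nonconventional convergence theorem for the `d-1` commuting actions
`n ↦ T i ^n (T 0)^{-n}` (`i ≠ 0`).  Then there is a unique probability measure
`ν = μ^{*d}` on `X^d` with
`ν(A 0 × ⋯ × A (d-1)) = lim_N (1/|I N|) ∑_{n ∈ I N + a N} ∫ ∏ i, 1_{A i} ∘ T i ^n dμ`
for every Følner sequence `(I N)` and base-point sequence `(a N)`. -/
theorem furstenberg_self_joining_exists_unique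
    {X : Type*} [MeasurableSpace X] [StandardBorelSpace X]
    (μ : Measure X) [IsProbabilityMeasure μ]
    (r d : ℕ) (hd : 0 < d)
    (T : Fin d → (Fin r → ℤ) → X → X)
    (hmp : ∀ i n, MeasurePreserving (T i n) μ μ)
    (hmeasT : ∀ i n, Measurable (T i n))
    (hid : ∀ i x, T i 0 x = x)
    (hadd : ∀ i n m x, T i (n + m) x = T i n (T i m x))
    (hcomm : ∀ i j n m x, T i n (T j m x) = T j m (T i n x))
    -- the rank-(d-1) nonconventional convergence theorem for the actions
    -- `n ↦ T i ^ n ∘ (T 0) ^ (-n)`, `i ≠ 0`: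
    (H : ∀ g : Fin d → X → ℝ, (∀ i, Measurable (g i)) →
      (∀ i, ∃ C : ℝ, ∀ x, |g i x| ≤ C) →
      ∃ L : X → ℝ, ∀ (I : ℕ → Finset (Fin r → ℤ)) (a : ℕ → Fin r → ℤ),
        (∀ N, (I N).Nonempty) →
        (∀ v : Fin r → ℤ, Tendsto
          (fun N => ((((I N).image (· + v)) ∆ (I N)).card : ℝ) / ((I N).card : ℝ))
          atTop (nhds 0)) →
        Tendsto (fun N => eLpNorm ((fun x => (((I N).card : ℝ)⁻¹ *
            ∑ n ∈ I N, ∏ i ∈ Finset.univ.erase (⟨0, hd⟩ : Fin d),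
              g i (T i (n + a N) (T ⟨0, hd⟩ (-(n + a N)) x)))) - L) 2 μ)
          atTop (nhds 0)) :
    ∃! ν : Measure (Fin d → X), IsProbabilityMeasure ν ∧
      ∀ A : Fin d → Set X, (∀ i, MeasurableSet (A i)) →
        ∀ (I : ℕ → Finset (Fin r → ℤ)) (a : ℕ → Fin r → ℤ),
          (∀ N, (I N).Nonempty) →
          (∀ v : Fin r → ℤ, Tendsto
            (fun N => ((((I N).image (· + v)) ∆ (I N)).card : ℝ) / ((I N).card : ℝ))
            atTop (nhds 0)) →
          Tendsto (fun N => ((I N).card : ℝ)⁻¹ *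
              ∑ n ∈ I N, ∫ x, ∏ i, (A i).indicator (fun _ => (1:ℝ)) (T i (n + a N) x) ∂μ)
            atTop (nhds (ν (Set.univ.pi A)).toReal) := by
  exact FSJ.main_result μ r d T hmp hid hadd hcomm
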